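/- Let f(t₁,…,t_d) be an ℝ-valued infinitely differentiable function on an open subset of ℝᵈ on which t_j ≠ 0. Then for every n ∈ ℕ, ∂_{t_j}² D^{t_j}(n){f} = D^{t_j}(n){∂_{t_j}² f} − 2n D^{t_j}(n+1){f}. -/

import Mathlib

noncomputable section

/-- The partial derivative `∂_{t_j}` of `f : ℝᵈ → ℝ`. -/
def pdj (d : ℕ) (j : Fin d) (f : (Fin d → ℝ) → ℝ) : (Fin d → ℝ) → ℝ :=
  fun t => fderiv ℝ f t (Pi.single j 1)

/-- The operator `D_{t_j}(n)`: `D_{t_j}(0){f} = f`,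
`D_{t_j}(n+1){f} = (1/t_j) ∂_{t_j}(D_{t_j}(n){f})`. -/
def DlowJ (d : ℕ) (j : Fin d) : ℕ → ((Fin d → ℝ) → ℝ) → ((Fin d → ℝ) → ℝ)
  | 0, f => f
  | n + 1, f => fun t => (t j)⁻¹ * pdj d j (DlowJ d j n f) t

/-- The operator `D^{t_j}(n)`: `D^{t_j}(0){f} = f`,
`D^{t_j}(n){f} = ∂_{t_j}(D^{t_j}(n-1){f} / t_j)`. -/
def DupJ (d : ℕ) (j : Fin d) : ℕ → ((Fin d → ℝ) → ℝ) → ((Fin d → ℝ) → ℝ)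
  | 0, f => f
  | n + 1, f => pdj d j (fun t => DupJ d j n f t / t j)

section PartialDerivative

variable {d : ℕ} {j : Fin d} {U : Set (Fin d → ℝ)} {f g : (Fin d → ℝ) → ℝ}

lemma pdj_eqOn (hU : IsOpen U) (h : Set.EqOn f g U) : Set.EqOn (pdj d j f) (pdj d j g) U := by
  intro t ht
  simp only [pdj, (h.eventuallyEq_of_mem (hU.mem_nhds ht)).fderiv_eq]

lemma contDiffOn_pdj (hU : IsOpen U) (hf : ContDiffOn ℝ (⊤ : ℕ∞) f U) :
    ContDiffOn ℝ (⊤ : ℕ∞) (pdj d j f) U :=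
  (hf.fderiv_of_isOpen hU (by simp)).clm_apply contDiffOn_const

lemma contDiffOn_div_coord (hUj : ∀ t ∈ U, t j ≠ 0) (hf : ContDiffOn ℝ (⊤ : ℕ∞) f U) :
    ContDiffOn ℝ (⊤ : ℕ∞) (fun t => f t / t j) U :=
  hf.div (contDiff_apply ℝ ℝ j).contDiffOn hUj

lemma differentiableAt_of_contDiffOn_top (hU : IsOpen U) (hf : ContDiffOn ℝ (⊤ : ℕ∞) f U)
    {t : Fin d → ℝ} (ht : t ∈ U) : DifferentiableAt ℝ f t :=
  (hf.contDiffAt (hU.mem_nhds ht)).differentiableAt (by simp)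

lemma contDiffOn_DupJ (hU : IsOpen U) (hUj : ∀ t ∈ U, t j ≠ 0)
    (hf : ContDiffOn ℝ (⊤ : ℕ∞) f U) (n : ℕ) : ContDiffOn ℝ (⊤ : ℕ∞) (DupJ d j n f) U := by
  induction n with
  | zero => exact hf
  | succ n ih => exact contDiffOn_pdj hU (contDiffOn_div_coord hUj ih)

lemma pdj_sub {t : Fin d → ℝ} (hf : DifferentiableAt ℝ f t) (hg : DifferentiableAt ℝ g t) :
    pdj d j (fun s => f s - g s) t = pdj d j f t - pdj d j g t := by
  simp [pdj, fderiv_fun_sub hf hg]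

lemma pdj_const_mul {t : Fin d → ℝ} (c : ℝ) (hf : DifferentiableAt ℝ f t) :
    pdj d j (fun s => c * f s) t = c * pdj d j f t := by
  simp [pdj, fderiv_const_mul hf c]

lemma pdj_div_coord {t : Fin d → ℝ} (ht : t j ≠ 0) (hf : DifferentiableAt ℝ f t) :
    pdj d j (fun s => f s / s j) t = pdj d j f t / t j - f t / t j / t j := by
  have hp : HasFDerivAt (fun s : Fin d → ℝ => s j)
      (ContinuousLinearMap.proj j : (Fin d → ℝ) →L[ℝ] ℝ) t := hasFDerivAt_apply j t
  have h := (hf.hasFDerivAt.mul ((hasDerivAt_inv ht).comp_hasFDerivAt t hp)).fderiv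
  have hmul : (fun s => f s / s j) = f * ((fun x : ℝ => x⁻¹) ∘ fun s => s j) := by
    ext s
    simp [div_eq_mul_inv]
  rw [pdj, hmul, h]
  simp [pdj]
  field_simp
  ring

/-- On smooth functions, `∂²` commutes with division by the coordinate `t_j` up to
`-2 t_j⁻¹ ∂ t_j⁻¹`. -/
lemma pdj_pdj_div_coord (hU : IsOpen U) (hUj : ∀ t ∈ U, t j ≠ 0)
    (hf : ContDiffOn ℝ (⊤ : ℕ∞) f U) :
    Set.EqOn (pdj d j (pdj d j (fun s => f s / s j)))
      (fun t => pdj d j (pdj d j f) t / t j - 2 * (pdj d j (fun s => f s / s j) t / t j)) U := by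
  intro t ht
  have hf' := contDiffOn_pdj (j := j) hU hf
  have hq := contDiffOn_div_coord hUj hf
  have hdiv : Set.EqOn (pdj d j (fun s => f s / s j))
      (fun t => pdj d j f t / t j - f t / t j / t j) U := fun s hs =>
    pdj_div_coord (hUj s hs) (differentiableAt_of_contDiffOn_top hU hf hs)
  have diff {h : (Fin d → ℝ) → ℝ} (hh : ContDiffOn ℝ (⊤ : ℕ∞) h U) : DifferentiableAt ℝ h t :=
    differentiableAt_of_contDiffOn_top hU hh ht
  rw [pdj_eqOn hU hdiv ht,
    pdj_sub (diff (contDiffOn_div_coord hUj hf')) (diff (contDiffOn_div_coord hUj hq)),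
    pdj_div_coord (hUj t ht) (diff hf'), pdj_div_coord (hUj t ht) (diff hq)]
  simp only [hdiv ht]
  ring

end PartialDerivative

/-- **Lemma 1 (ii):** `∂_{t_j}² D^{t_j}(n){f} = D^{t_j}(n){∂_{t_j}² f} − 2n D^{t_j}(n+1){f}`
for a smooth function `f` on an open set where `t_j ≠ 0`. -/
theorem lemma1_ii (d : ℕ) (j : Fin d) (U : Set (Fin d → ℝ)) (hU : IsOpen U)
    (hUj : ∀ t ∈ U, t j ≠ 0) (f : (Fin d → ℝ) → ℝ) (hf : ContDiffOn ℝ (⊤ : ℕ∞) f U) (n : ℕ) :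
    ∀ t ∈ U, pdj d j (pdj d j (DupJ d j n f)) t
      = DupJ d j n (pdj d j (pdj d j f)) t - (2 * n : ℝ) * DupJ d j (n + 1) f t := by
  induction n with
  | zero => simp [DupJ]
  | succ n ih =>
    intro t ht
    have hn := contDiffOn_DupJ hU hUj hf n
    have hn1 := contDiffOn_DupJ hU hUj hf (n + 1)
    have hn'' := contDiffOn_DupJ hU hUj
      (contDiffOn_pdj (j := j) hU (contDiffOn_pdj (j := j) hU hf)) n
    have hstep : Set.EqOn (pdj d j (pdj d j (fun s => DupJ d j n f s / s j)))
        (fun s => DupJ d j n (pdj d j (pdj d j f)) s / s j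
          - (2 * (n + 1 : ℕ) : ℝ) * (DupJ d j (n + 1) f s / s j)) U := by
      intro s hs
      rw [pdj_pdj_div_coord hU hUj hn hs]
      simp only [ih s hs, DupJ]
      push_cast
      ring
    have diff {h : (Fin d → ℝ) → ℝ} (hh : ContDiffOn ℝ (⊤ : ℕ∞) h U) :
        DifferentiableAt ℝ (fun s => h s / s j) t :=
      differentiableAt_of_contDiffOn_top hU (contDiffOn_div_coord hUj hh) ht
    have key := pdj_eqOn (j := j) hU hstep ht
    rw [pdj_sub (diff hn'') ((diff hn1).const_mul _), pdj_const_mul _ (diff hn1)] at key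
    exact key
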